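/- Let f be continuous, nondecreasing, satisfying (P) and (KO). Then the large solution of Δu = f(u) in the open unit ball B of ℝ^N is unique: any two large solutions u₁, u₂ on B coincide, u₁(x) = u₂(x) for all x ∈ B. -/

import Mathlib

open MeasureTheory Filter Metric Set

/-- The Laplacian of `u : ℝ^N → ℝ` at a point, as the sum of the second
derivatives in the coordinate directions. -/
noncomputable def lapl {N : ℕ} (u : EuclideanSpace ℝ (Fin N) → ℝ)
    (x : EuclideanSpace ℝ (Fin N)) : ℝ :=
  ∑ i : Fin N, iteratedFDeriv ℝ 2 u x ![EuclideanSpace.single i 1, EuclideanSpace.single i 1]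

/-- A large solution of Δu = f(u) on the open unit ball of ℝ^N. -/
def IsLargeSolution {N : ℕ} (f : ℝ → ℝ) (u : EuclideanSpace ℝ (Fin N) → ℝ) : Prop :=
  ContDiffOn ℝ 2 u (ball 0 1) ∧
  (∀ x ∈ ball (0 : EuclideanSpace ℝ (Fin N)) 1, lapl u x = f (u x)) ∧
  ∀ x₀ ∈ sphere (0 : EuclideanSpace ℝ (Fin N)) 1,
    Tendsto u (nhdsWithin x₀ (ball 0 1)) atTop

open Topology

/-- At a local maximum the first derivative vanishes and the second one is nonpositive. -/
lemma IsLocalMax.deriv_eq_zero_and_second_nonpos {q q₁ : ℝ → ℝ} {s₀ q₂ : ℝ}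
    (hmax : IsLocalMax q s₀) (hq : ∀ᶠ s in 𝓝 s₀, HasDerivAt q (q₁ s) s)
    (hq₁ : HasDerivAt q₁ q₂ s₀) : q₁ s₀ = 0 ∧ q₂ ≤ 0 := by
  have h0 : q₁ s₀ = 0 := hmax.hasDerivAt_eq_zero hq.self_of_nhds
  refine ⟨h0, ?_⟩
  by_contra! hpos
  have hd : deriv q =ᶠ[𝓝 s₀] q₁ := hq.mono fun s hs => hs.deriv
  have hmin : IsLocalMin q s₀ := by
    refine isLocalMin_of_deriv_deriv_pos ?_ ?_ hq.self_of_nhds.continuousAt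
    · rwa [hd.deriv_eq, hq₁.deriv]
    · rw [hd.self_of_nhds, h0]
  have hconst : q =ᶠ[𝓝 s₀] fun _ => q s₀ := by
    filter_upwards [hmax, hmin] with s h1 h2 using le_antisymm h1 h2
  have hz : q₁ =ᶠ[𝓝 s₀] fun _ => 0 := by
    filter_upwards [hconst.eventuallyEq_nhds, hd] with s h1 h2
    rw [← h2, h1.deriv_eq, deriv_const]
  have := hz.deriv_eq
  rw [hq₁.deriv, deriv_const] at this
  exact hpos.ne' this

section Curves

variable {E : Type*} [NormedAddCommGroup E] [NormedSpace ℝ E]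

/-- First derivatives along a curve of a function which is `C²` at the base point. -/
lemma ContDiffAt.eventually_hasDerivAt_comp_curve {v : E → ℝ} {γ γ₁ : ℝ → E} {s₀ : ℝ}
    (hv : ContDiffAt ℝ 2 v (γ s₀)) (hγ : ∀ᶠ s in 𝓝 s₀, HasDerivAt γ (γ₁ s) s) :
    ∀ᶠ s in 𝓝 s₀, HasDerivAt (fun s => v (γ s)) (fderiv ℝ v (γ s) (γ₁ s)) s := by
  have hc : ContinuousAt γ s₀ := hγ.self_of_nhds.continuousAt
  have hev : ∀ᶠ x in 𝓝 (γ s₀), ContDiffAt ℝ 2 v x := hv.eventually (by simp)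
  filter_upwards [hγ, hc.eventually hev] with s h1 h2
  exact (h2.differentiableAt (by simp)).hasFDerivAt.comp_hasDerivAt s h1

/-- Second derivative along a curve of a function which is `C²` at the base point. -/
lemma ContDiffAt.hasDerivAt_fderiv_comp_curve {v : E → ℝ} {γ γ₁ : ℝ → E} {γ₂ : E} {s₀ : ℝ}
    (hv : ContDiffAt ℝ 2 v (γ s₀)) (hγ : HasDerivAt γ (γ₁ s₀) s₀)
    (hγ₁ : HasDerivAt γ₁ γ₂ s₀) :
    HasDerivAt (fun s => fderiv ℝ v (γ s) (γ₁ s))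
      (fderiv ℝ (fderiv ℝ v) (γ s₀) (γ₁ s₀) (γ₁ s₀) + fderiv ℝ v (γ s₀) γ₂) s₀ := by
  have h1 : ContDiffAt ℝ 1 (fderiv ℝ v) (γ s₀) :=
    hv.fderiv_right (m := 1) (by norm_num [one_add_one_eq_two])
  have h2 : HasDerivAt (fun s => fderiv ℝ v (γ s))
      (fderiv ℝ (fderiv ℝ v) (γ s₀) (γ₁ s₀)) s₀ :=
    (h1.differentiableAt (by simp)).hasFDerivAt.comp_hasDerivAt s₀ hγ
  exact h2.clm_apply hγ₁

end Curves

section Laplacian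

variable {N : ℕ}

/-- The Laplacian may be computed in any orthonormal basis. -/
lemma lapl_eq_sum_orthonormalBasis (u : EuclideanSpace ℝ (Fin N) → ℝ)
    (b : OrthonormalBasis (Fin N) ℝ (EuclideanSpace ℝ (Fin N)))
    (x : EuclideanSpace ℝ (Fin N)) :
    lapl u x = ∑ i, fderiv ℝ (fderiv ℝ u) x (b i) (b i) := by
  have h1 := congrFun (InnerProductSpace.laplacian_eq_iteratedFDeriv_orthonormalBasis u
    (EuclideanSpace.basisFun (Fin N) ℝ)) x
  have h2 := congrFun (InnerProductSpace.laplacian_eq_iteratedFDeriv_orthonormalBasis u b) x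
  simp only [EuclideanSpace.basisFun_apply] at h1
  rw [lapl, ← h1, h2]
  simp [iteratedFDeriv_two_apply]

lemma lapl_neg (u : EuclideanSpace ℝ (Fin N) → ℝ) (x : EuclideanSpace ℝ (Fin N)) :
    lapl (fun y => -u y) x = -lapl u x := by
  have h : (fun y => -u y) = -u := rfl
  simp only [lapl, h, iteratedFDeriv_neg_apply, neg_apply,
    Finset.sum_neg_distrib]

/-- At a maximum point of `v` on a sphere centred at the origin, the Laplacian is at most its
radial part. -/
lemma lapl_le_radial_of_isMaxOn_sphere {v : EuclideanSpace ℝ (Fin N) → ℝ}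
    {ω : EuclideanSpace ℝ (Fin N)} {r : ℝ} (hr : 0 < r) (hω : ‖ω‖ = 1)
    (hv : ContDiffAt ℝ 2 v (r • ω)) (hmax : ∀ y, ‖y‖ = r → v y ≤ v (r • ω)) :
    lapl v (r • ω) ≤ fderiv ℝ (fderiv ℝ v) (r • ω) ω ω
      + (N - 1) / r * fderiv ℝ v (r • ω) ω := by
  have hN : 0 < N := by
    rcases Nat.eq_zero_or_pos N with rfl | h
    · simp [Subsingleton.elim ω 0] at hω
    · exact h
  let i₀ : Fin N := ⟨0, hN⟩
  obtain ⟨b, hb⟩ := Orthonormal.exists_orthonormalBasis_extension_of_card_eq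
    (𝕜 := ℝ) (E := EuclideanSpace ℝ (Fin N)) (ι := Fin N) (by simp)
    (v := fun _ => ω) (s := {i₀}) (by
      refine ⟨fun i => by simpa using hω, fun i j hij => (hij (Subsingleton.elim _ _)).elim⟩)
  have hb0 : b i₀ = ω := hb i₀ rfl
  have htan : ∀ i, i ≠ i₀ →
      fderiv ℝ (fderiv ℝ v) (r • ω) (b i) (b i) ≤ fderiv ℝ v (r • ω) ω / r := by
    intro i hi
    have horth : inner ℝ ω (b i) = 0 := by
      rw [← hb0]; exact b.orthonormal.2 (Ne.symm hi)
    set γ : ℝ → EuclideanSpace ℝ (Fin N) :=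
      fun s => (r * Real.cos s) • ω + (r * Real.sin s) • b i with hγdef
    set γ₁ : ℝ → EuclideanSpace ℝ (Fin N) :=
      fun s => (r * -Real.sin s) • ω + (r * Real.cos s) • b i with hγ₁def
    have hγ : ∀ s, HasDerivAt γ (γ₁ s) s := fun s =>
      (((Real.hasDerivAt_cos s).const_mul r).smul_const ω).add
        (((Real.hasDerivAt_sin s).const_mul r).smul_const (b i))
    have hγ₁ : HasDerivAt γ₁ ((-r) • ω) 0 := by
      have h := ((((Real.hasDerivAt_sin 0).neg).const_mul r).smul_const ω).add
        (((Real.hasDerivAt_cos 0).const_mul r).smul_const (b i))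
      exact HasDerivAt.congr_deriv (f := γ₁) h (by simp)
    have hγ0 : γ 0 = r • ω := by simp [hγdef]
    have hγ10 : γ₁ 0 = r • b i := by simp [hγ₁def]
    have hnorm : ∀ s, ‖γ s‖ = r := by
      intro s
      have h1 : ‖γ s‖ ^ 2 = r ^ 2 := by
        rw [hγdef, norm_add_sq_real]
        simp only [norm_smul, hω, b.norm_eq_one, inner_smul_left, inner_smul_right, horth]
        simp only [mul_one, mul_zero, add_zero, Real.norm_eq_abs, sq_abs]
        linear_combination r ^ 2 * Real.cos_sq_add_sin_sq s
      exact (sq_eq_sq₀ (norm_nonneg _) hr.le).1 h1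
    have hv0 : ContDiffAt ℝ 2 v (γ 0) := by rwa [hγ0]
    have hloc : IsLocalMax (fun s => v (γ s)) 0 :=
      Eventually.of_forall fun s => by
        simp only [hγ0]; exact hmax _ (hnorm s)
    have h2 := (hloc.deriv_eq_zero_and_second_nonpos
      (hv0.eventually_hasDerivAt_comp_curve (Eventually.of_forall hγ))
      (hv0.hasDerivAt_fderiv_comp_curve (hγ 0) hγ₁)).2
    rw [hγ0, hγ10] at h2
    simp only [map_smul, smul_apply, smul_eq_mul] at h2
    rw [le_div_iff₀ hr]
    nlinarith
  rw [lapl_eq_sum_orthonormalBasis v b, ← Finset.add_sum_erase _ _ (Finset.mem_univ i₀), hb0]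
  gcongr
  refine (Finset.sum_le_sum fun i hi => htan i (Finset.ne_of_mem_erase hi)).trans (le_of_eq ?_)
  rw [Finset.sum_const, Finset.card_erase_of_mem (Finset.mem_univ _), Finset.card_univ,
    Fintype.card_fin, nsmul_eq_mul, Nat.cast_sub hN]
  push_cast
  ring

/-- At a minimum point of `u` on a sphere centred at the origin, the Laplacian is at least its
radial part. -/
lemma radial_le_lapl_of_isMinOn_sphere {u : EuclideanSpace ℝ (Fin N) → ℝ}
    {θ : EuclideanSpace ℝ (Fin N)} {r : ℝ} (hr : 0 < r) (hθ : ‖θ‖ = 1)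
    (hu : ContDiffAt ℝ 2 u (r • θ)) (hmin : ∀ y, ‖y‖ = r → u (r • θ) ≤ u y) :
    fderiv ℝ (fderiv ℝ u) (r • θ) θ θ + (N - 1) / r * fderiv ℝ u (r • θ) θ
      ≤ lapl u (r • θ) := by
  have h := lapl_le_radial_of_isMaxOn_sphere hr hθ hu.neg fun y hy => neg_le_neg (hmin y hy)
  have h1 : fderiv ℝ (fun y => -u y) = -fderiv ℝ u := by
    ext1 y; simp
  have h2 : fderiv ℝ (-fderiv ℝ u) (r • θ) = -fderiv ℝ (fderiv ℝ u) (r • θ) := fderiv_neg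
  rw [lapl_neg, h1, h2] at h
  simp only [neg_apply, Pi.neg_apply] at h
  linarith

end Laplacian

section Touching

variable {N : ℕ}

/-- Comparison of the Laplacians where `v - u + κ r²` has a local maximum along the radius, at a
maximum point of `v` and a minimum point of `u` on the same sphere. -/
lemma lapl_add_le_lapl_of_isLocalMax_radial {v u : EuclideanSpace ℝ (Fin N) → ℝ}
    {ω θ : EuclideanSpace ℝ (Fin N)} {r κ : ℝ} (hN : 1 ≤ N) (hr : 0 < r) (hκ : 0 ≤ κ)
    (hω : ‖ω‖ = 1) (hθ : ‖θ‖ = 1)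
    (hv : ContDiffAt ℝ 2 v (r • ω)) (hu : ContDiffAt ℝ 2 u (r • θ))
    (hmax : ∀ y, ‖y‖ = r → v y ≤ v (r • ω)) (hmin : ∀ y, ‖y‖ = r → u (r • θ) ≤ u y)
    (hloc : IsLocalMax (fun s => v (s • ω) - u (s • θ) + κ * s ^ 2) r) :
    lapl v (r • ω) + 2 * κ ≤ lapl u (r • θ) := by
  have hray : ∀ (ζ : EuclideanSpace ℝ (Fin N)) (s : ℝ),
      HasDerivAt (fun s : ℝ => s • ζ) ζ s := fun ζ s => by
    simpa using (hasDerivAt_id s).smul_const ζ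
  have hsq : ∀ s : ℝ, HasDerivAt (fun s : ℝ => κ * s ^ 2) (κ * (2 * s)) s := fun s => by
    simpa using ((hasDerivAt_id s).pow 2).const_mul κ
  have hlin : HasDerivAt (fun s : ℝ => κ * (2 * s)) (κ * 2) r := by
    simpa using ((hasDerivAt_id r).const_mul 2).const_mul κ
  have hv1 := hv.eventually_hasDerivAt_comp_curve (γ := fun s : ℝ => s • ω)
    (Eventually.of_forall (hray ω))
  have hu1 := hu.eventually_hasDerivAt_comp_curve (γ := fun s : ℝ => s • θ)
    (Eventually.of_forall (hray θ))
  have hv2 := hv.hasDerivAt_fderiv_comp_curve (γ := fun s : ℝ => s • ω) (hray ω r)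
    (hasDerivAt_const r ω)
  have hu2 := hu.hasDerivAt_fderiv_comp_curve (γ := fun s : ℝ => s • θ) (hray θ r)
    (hasDerivAt_const r θ)
  obtain ⟨hd1, hd2⟩ := hloc.deriv_eq_zero_and_second_nonpos
    (by filter_upwards [hv1, hu1] with s h1 h2 using (h1.sub h2).add (hsq s))
    ((hv2.sub hu2).add hlin)
  simp only [map_zero, add_zero] at hd2
  have hLv := lapl_le_radial_of_isMaxOn_sphere hr hω hv hmax
  have hLu := radial_le_lapl_of_isMinOn_sphere hr hθ hu hmin
  have hN' : (0 : ℝ) ≤ (N - 1) / r :=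
    div_nonneg (sub_nonneg.2 (by exact_mod_cast hN)) hr.le
  have hle : fderiv ℝ v (r • ω) ω ≤ fderiv ℝ u (r • θ) θ := by
    simp only [Pi.add_apply, Pi.sub_apply] at hd1
    linarith [mul_nonneg hκ hr.le]
  have := mul_le_mul_of_nonneg_left hle hN'
  linarith

/-- The radial speed `H' = H ^ (N - 1)` turns the radial part of the Laplacian into a pure second
derivative. -/
lemma hasDerivAt_fderiv_comp_radial {v : EuclideanSpace ℝ (Fin N) → ℝ}
    {ω : EuclideanSpace ℝ (Fin N)} {H : ℝ → ℝ} {α β s₀ : ℝ} (hN : 1 ≤ N)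
    (hpos : 0 < H (α * s₀ + β))
    (hH : ∀ᶠ s in 𝓝 (α * s₀ + β), HasDerivAt H (H s ^ (N - 1)) s)
    (hv : ContDiffAt ℝ 2 v (H (α * s₀ + β) • ω)) :
    (∀ᶠ s in 𝓝 s₀, HasDerivAt (fun s => v (H (α * s + β) • ω))
      (fderiv ℝ v (H (α * s + β) • ω) ((α * H (α * s + β) ^ (N - 1)) • ω)) s) ∧
    HasDerivAt (fun s => fderiv ℝ v (H (α * s + β) • ω) ((α * H (α * s + β) ^ (N - 1)) • ω))
      ((α * H (α * s₀ + β) ^ (N - 1)) ^ 2 *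
        (fderiv ℝ (fderiv ℝ v) (H (α * s₀ + β) • ω) ω ω
          + (N - 1) / H (α * s₀ + β) * fderiv ℝ v (H (α * s₀ + β) • ω) ω)) s₀ := by
  have haff : ∀ s, HasDerivAt (fun s : ℝ => α * s + β) α s := fun s => by
    simpa using ((hasDerivAt_id s).const_mul α).add_const β
  have hR : ∀ᶠ s in 𝓝 s₀, HasDerivAt (fun s => H (α * s + β))
      (α * H (α * s + β) ^ (N - 1)) s := by
    have hc : Tendsto (fun s : ℝ => α * s + β) (𝓝 s₀) (𝓝 (α * s₀ + β)) := (haff s₀).continuousAt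
    filter_upwards [hc.eventually hH] with s hs
    have h := hs.comp s (haff s)
    rw [mul_comm] at h
    exact h
  have hγ : ∀ᶠ s in 𝓝 s₀, HasDerivAt (fun s => H (α * s + β) • ω)
      ((α * H (α * s + β) ^ (N - 1)) • ω) s := hR.mono fun s hs => hs.smul_const ω
  have hγ₁ := ((hR.self_of_nhds.pow (N - 1)).const_mul α).smul_const ω
  refine ⟨hv.eventually_hasDerivAt_comp_curve (γ := fun s => H (α * s + β) • ω) hγ, ?_⟩
  have hd := hv.hasDerivAt_fderiv_comp_curve (γ := fun s => H (α * s + β) • ω)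
    (γ₁ := fun s => (α * H (α * s + β) ^ (N - 1)) • ω) hγ.self_of_nhds hγ₁
  refine hd.congr_deriv ?_
  obtain ⟨n, rfl⟩ : ∃ n, N = n + 1 := ⟨N - 1, by omega⟩
  simp only [map_smul, smul_apply, smul_eq_mul, Nat.add_sub_cancel]
  rcases n with _ | n
  · simp; ring
  · simp only [Nat.add_sub_cancel]
    push_cast
    field_simp
    ring

/-- Comparison of the Laplacians where `v - u` has a local maximum along two radii run through at
the speeds `H (s)` and `H (α s + β)`, at a maximum point of `v` and a minimum point of `u`
on the corresponding spheres. -/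
lemma mul_lapl_le_mul_lapl_of_isLocalMax {v u : EuclideanSpace ℝ (Fin N) → ℝ}
    {ω θ : EuclideanSpace ℝ (Fin N)} {H : ℝ → ℝ} {α β s₀ : ℝ} (hN : 1 ≤ N)
    (hω : ‖ω‖ = 1) (hθ : ‖θ‖ = 1) (hr : 0 < H s₀) (hρ : 0 < H (α * s₀ + β))
    (hHr : ∀ᶠ s in 𝓝 s₀, HasDerivAt H (H s ^ (N - 1)) s)
    (hHρ : ∀ᶠ s in 𝓝 (α * s₀ + β), HasDerivAt H (H s ^ (N - 1)) s)
    (hv : ContDiffAt ℝ 2 v (H s₀ • ω)) (hu : ContDiffAt ℝ 2 u (H (α * s₀ + β) • θ))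
    (hmax : ∀ y, ‖y‖ = H s₀ → v y ≤ v (H s₀ • ω))
    (hmin : ∀ y, ‖y‖ = H (α * s₀ + β) → u (H (α * s₀ + β) • θ) ≤ u y)
    (hloc : IsLocalMax (fun s => v (H s • ω) - u (H (α * s + β) • θ)) s₀) :
    (H s₀ ^ (N - 1)) ^ 2 * lapl v (H s₀ • ω)
      ≤ (α * H (α * s₀ + β) ^ (N - 1)) ^ 2 * lapl u (H (α * s₀ + β) • θ) := by
  obtain ⟨hv1, hv2⟩ := hasDerivAt_fderiv_comp_radial (α := 1) (β := 0) (s₀ := s₀) (ω := ω)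
    (v := v) (H := H) hN (by simpa using hr) (by simpa using hHr) (by simpa using hv)
  obtain ⟨hu1, hu2⟩ := hasDerivAt_fderiv_comp_radial hN hρ hHρ hu
  simp only [one_mul, add_zero] at hv1 hv2
  have hd := (hloc.deriv_eq_zero_and_second_nonpos
    (by filter_upwards [hv1, hu1] with s h1 h2 using h1.sub h2) (hv2.sub hu2)).2
  have hLv := mul_le_mul_of_nonneg_left (lapl_le_radial_of_isMaxOn_sphere hr hω hv hmax)
    (sq_nonneg (H s₀ ^ (N - 1)))
  have hLu := mul_le_mul_of_nonneg_left (radial_le_lapl_of_isMinOn_sphere hρ hθ hu hmin)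
    (sq_nonneg (α * H (α * s₀ + β) ^ (N - 1)))
  linarith

/-- At a local maximum of `v - u + κ ‖x‖²` at the origin. -/
lemma lapl_add_le_lapl_of_isLocalMax_zero {v u : EuclideanSpace ℝ (Fin N) → ℝ} {κ : ℝ}
    (hN : 1 ≤ N) (hκ : 0 ≤ κ) (hv : ContDiffAt ℝ 2 v 0) (hu : ContDiffAt ℝ 2 u 0)
    (hloc : IsLocalMax (fun x => v x - u x + κ * ‖x‖ ^ 2) 0) :
    lapl v 0 + 2 * κ ≤ lapl u 0 := by
  set b := EuclideanSpace.basisFun (Fin N) ℝ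
  have key : ∀ i, fderiv ℝ (fderiv ℝ v) 0 (b i) (b i) + 2 * κ
      ≤ fderiv ℝ (fderiv ℝ u) 0 (b i) (b i) := by
    intro i
    have hray : ∀ s : ℝ, HasDerivAt (fun s : ℝ => s • b i) (b i) s := fun s => by
      simpa using (hasDerivAt_id s).smul_const (b i)
    have hsq : ∀ s : ℝ, HasDerivAt (fun s : ℝ => κ * s ^ 2) (κ * (2 * s)) s := fun s => by
      simpa using ((hasDerivAt_id s).pow 2).const_mul κ
    have hlin : HasDerivAt (fun s : ℝ => κ * (2 * s)) (κ * 2) 0 := by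
      simpa using ((hasDerivAt_id (0 : ℝ)).const_mul 2).const_mul κ
    have h0 : (0 : ℝ) • b i = 0 := zero_smul _ _
    have hv' : ContDiffAt ℝ 2 v ((0 : ℝ) • b i) := by rwa [h0]
    have hu' : ContDiffAt ℝ 2 u ((0 : ℝ) • b i) := by rwa [h0]
    have hv1 := hv'.eventually_hasDerivAt_comp_curve (γ := fun s : ℝ => s • b i)
      (Eventually.of_forall hray)
    have hu1 := hu'.eventually_hasDerivAt_comp_curve (γ := fun s : ℝ => s • b i)
      (Eventually.of_forall hray)
    have hv2 := hv'.hasDerivAt_fderiv_comp_curve (γ := fun s : ℝ => s • b i) (hray 0)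
      (hasDerivAt_const 0 (b i))
    have hu2 := hu'.hasDerivAt_fderiv_comp_curve (γ := fun s : ℝ => s • b i) (hray 0)
      (hasDerivAt_const 0 (b i))
    have hloc' : IsLocalMax (fun s : ℝ => v (s • b i) - u (s • b i) + κ * s ^ 2) 0 := by
      have hc : Tendsto (fun s : ℝ => s • b i) (𝓝 0) (𝓝 0) := by
        simpa [h0] using (hray 0).continuousAt.tendsto
      filter_upwards [hc.eventually hloc] with s hs
      simpa [norm_smul] using hs
    have hd := (hloc'.deriv_eq_zero_and_second_nonpos
      (by filter_upwards [hv1, hu1] with s h1 h2 using (h1.sub h2).add (hsq s))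
      ((hv2.sub hu2).add hlin)).2
    simp only [map_zero, add_zero, h0] at hd
    linarith
  rw [lapl_eq_sum_orthonormalBasis v b, lapl_eq_sum_orthonormalBasis u b]
  have hsum := Finset.sum_le_sum fun i (_ : i ∈ Finset.univ) => key i
  rw [Finset.sum_add_distrib, Finset.sum_const, Finset.card_univ, Fintype.card_fin,
    nsmul_eq_mul] at hsum
  have : (1 : ℝ) ≤ N := by exact_mod_cast hN
  nlinarith

end Touching

/-- A local solution of `H' = H ^ n` with `H 0 = 1`, together with a family of affine changes of
parameter `s ↦ (1 - ε A) s + ε` which increase `H` but decrease its speed. -/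
lemma exists_radial_parametrization (n : ℕ) : ∃ (H : ℝ → ℝ) (τ A : ℝ), 0 < τ ∧ 0 < A ∧ H 0 = 1 ∧
    (∀ s ∈ Ioo (-τ) τ, 0 < H s ∧ HasDerivAt H (H s ^ n) s) ∧
    ∀ ε s : ℝ, 0 < ε → ε < τ → ε * A < 1 → s ∈ Ioo (-τ) 0 →
      (1 - ε * A) * H ((1 - ε * A) * s + ε) ^ n < H s ^ n := by
  obtain ⟨H, hH0, e, he, hH⟩ :=
    ContDiffAt.exists_forall_mem_closedBall_exists_eq_forall_mem_Ioo_hasDerivAt₀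
      (f := fun x : ℝ => x ^ n) (x₀ := 1) (contDiff_id.pow n).contDiffAt 0
  have hev : ∀ᶠ s in 𝓝 (0 : ℝ), HasDerivAt H (H s ^ n) s := by
    filter_upwards [Ioo_mem_nhds (show 0 - e < 0 by linarith) (show (0 : ℝ) < 0 + e by linarith)]
      with s hs using hH s hs
  have hHc : ContinuousAt H 0 := hev.self_of_nhds.continuousAt
  have hφs := (hasStrictDerivAt_of_hasDerivAt_of_continuousAt hev (hHc.pow n)).pow n
  obtain ⟨L, S, hS, hL⟩ := hφs.hasStrictFDerivAt.exists_lipschitzOnWith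
  have hhalf : ∀ᶠ s in 𝓝 (0 : ℝ), 1 / 2 < H s ^ n :=
    (hHc.pow n).eventually (lt_mem_nhds (by simp [hH0]; norm_num))
  have hpos : ∀ᶠ s in 𝓝 (0 : ℝ), 0 < H s := hHc.eventually (lt_mem_nhds (by simp [hH0]))
  obtain ⟨τ₀, hτ₀, hball⟩ := Metric.eventually_nhds_iff.1
    (hev.and (hhalf.and (hpos.and (eventually_mem_set.2 hS))))
  have hall : ∀ s, |s| < τ₀ → HasDerivAt H (H s ^ n) s ∧ 1 / 2 < H s ^ n ∧ 0 < H s ∧ s ∈ S :=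
    fun s hs => hball (by simpa [Real.dist_eq] using hs)
  have hL0 : (0 : ℝ) ≤ L := L.2
  set A : ℝ := 4 * L + 4 with hA
  have hApos : 0 < A := by positivity
  refine ⟨H, min τ₀ (1 / A), A, by positivity, hApos, hH0, fun s hs => ?_, ?_⟩
  · have h := hall s (abs_lt.2 ⟨by linarith [hs.1, min_le_left τ₀ (1 / A)],
      hs.2.trans_le (min_le_left _ _)⟩)
    exact ⟨h.2.2.1, h.1⟩
  · intro ε s hε hετ hεA hs
    have hτ1 := min_le_left τ₀ (1 / A)
    have hτ2 := min_le_right τ₀ (1 / A)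
    have hAs : A * -s < 1 := by
      have : -s < 1 / A := by linarith [hs.1]
      rwa [lt_div_iff₀ hApos, mul_comm] at this
    have hs0 := hs.2
    have hlow : s < (1 - ε * A) * s + ε := by nlinarith [mul_pos hε hApos]
    have hup : (1 - ε * A) * s + ε ≤ ε := by nlinarith
    have h1 := hall s (abs_lt.2 ⟨by linarith [hs.1], by linarith⟩)
    have h2 := hall ((1 - ε * A) * s + ε) (abs_lt.2 ⟨by linarith [hs.1], by linarith⟩)
    have hd := hL.dist_le_mul _ h2.2.2.2 _ h1.2.2.2
    rw [Real.dist_eq, Real.dist_eq, abs_of_pos (sub_pos.2 hlow)] at hd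
    have hle := (le_abs_self _).trans hd
    have hE : (1 - ε * A) * s + ε - s = ε * (1 + A * -s) := by ring
    rw [hE] at hle
    have hinc : 0 ≤ (L : ℝ) * (ε * (1 + A * -s)) := by
      have : 0 ≤ A * -s := by nlinarith
      positivity
    have hinc2 : (L : ℝ) * (ε * (1 + A * -s)) ≤ ε * (2 * L) := by
      have := mul_le_mul_of_nonneg_left (show 1 + A * -s ≤ 2 by linarith) (mul_nonneg hL0 hε.le)
      linarith
    have hgain : ε * (2 * L + 2) < ε * A * H s ^ n := by
      have := mul_lt_mul_of_pos_left h1.2.1 (mul_pos hε hApos)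
      rw [hA] at this ⊢
      linarith
    calc (1 - ε * A) * H ((1 - ε * A) * s + ε) ^ n
        ≤ (1 - ε * A) * (H s ^ n + L * (ε * (1 + A * -s))) := by
          apply mul_le_mul_of_nonneg_left _ (by linarith)
          simp only [Pi.pow_apply] at hle
          linarith
      _ ≤ H s ^ n - ε * A * H s ^ n + L * (ε * (1 + A * -s)) := by
          nlinarith [mul_nonneg (mul_pos hε hApos).le hinc]
      _ < H s ^ n := by linarith

lemma strictMonoOn_of_hasDerivAt_pow {H : ℝ → ℝ} {τ : ℝ} {n : ℕ}
    (hH : ∀ s ∈ Ioo (-τ) τ, 0 < H s ∧ HasDerivAt H (H s ^ n) s) :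
    StrictMonoOn H (Ioo (-τ) τ) := by
  refine strictMonoOn_of_deriv_pos (convex_Ioo _ _)
    (fun s hs => (hH s hs).2.continuousAt.continuousWithinAt) fun s hs => ?_
  rw [interior_Ioo] at hs
  rw [(hH s hs).2.deriv]
  exact pow_pos (hH s hs).1 _

section Comparison

variable {N : ℕ}

/-- Blow-up at every boundary point is uniform. -/
lemma exists_radius_forall_lt {u : EuclideanSpace ℝ (Fin N) → ℝ}
    (hu : ∀ x₀ ∈ sphere (0 : EuclideanSpace ℝ (Fin N)) 1,
      Tendsto u (nhdsWithin x₀ (ball 0 1)) atTop) (C : ℝ) :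
    ∃ b < 1, ∀ y ∈ ball (0 : EuclideanSpace ℝ (Fin N)) 1, b < ‖y‖ → C < u y := by
  set O := interior {y | y ∈ ball (0 : EuclideanSpace ℝ (Fin N)) 1 → C < u y} with hO
  have hK : IsCompact (closedBall (0 : EuclideanSpace ℝ (Fin N)) 1 \ O) :=
    (isCompact_closedBall 0 1).diff isOpen_interior
  have hout : ∀ b : ℝ, (∀ y ∈ closedBall (0 : EuclideanSpace ℝ (Fin N)) 1 \ O, ‖y‖ ≤ b) →
      ∀ y ∈ ball (0 : EuclideanSpace ℝ (Fin N)) 1, b < ‖y‖ → C < u y := by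
    intro b hb y hy hby
    by_contra hCu
    refine (hb y ⟨ball_subset_closedBall hy, fun hyO => hCu ?_⟩).not_gt hby
    exact interior_subset hyO hy
  rcases (closedBall (0 : EuclideanSpace ℝ (Fin N)) 1 \ O).eq_empty_or_nonempty with he | hne
  · exact ⟨0, one_pos, hout 0 (by simp [he])⟩
  · obtain ⟨x, hx, hmax⟩ := hK.exists_isMaxOn hne continuous_norm.continuousOn
    refine ⟨‖x‖, lt_of_le_of_ne (mem_closedBall_zero_iff.1 hx.1) fun h1 => hx.2 ?_,
      hout _ fun y hy => hmax hy⟩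
    rw [hO, mem_interior_iff_mem_nhds]
    exact eventually_nhdsWithin_iff.1
      ((hu x (mem_sphere_zero_iff_norm.2 h1)).eventually_gt_atTop C)

/-- A bound on the gap between the largest value of `v` and the smallest value of `u` on a
sphere holds on all smaller spheres. -/
lemma sub_le_of_sub_le_on_sphere {f : ℝ → ℝ} (hN : 1 ≤ N) (hmono : Monotone f)
    {u v : EuclideanSpace ℝ (Fin N) → ℝ} (hu : IsLargeSolution f u) (hv : IsLargeSolution f v)
    {ρ c : ℝ} (hρ : ρ < 1) (hc : 0 ≤ c)
    (hb : ∀ x y, ‖x‖ = ρ → ‖y‖ = ρ → v x - u y ≤ c) :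
    ∀ x y, ‖x‖ = ‖y‖ → ‖x‖ ≤ ρ → v x - u y ≤ c := by
  intro x₁ y₁ hxy₁ hx₁
  by_contra! hlt
  have hCv : ∀ x, ‖x‖ < 1 → ContDiffAt ℝ 2 v x := fun x hx =>
    hv.1.contDiffAt (isOpen_ball.mem_nhds (mem_ball_zero_iff.2 hx))
  have hCu : ∀ x, ‖x‖ < 1 → ContDiffAt ℝ 2 u x := fun x hx =>
    hu.1.contDiffAt (isOpen_ball.mem_nhds (mem_ball_zero_iff.2 hx))
  obtain ⟨κ, hκ, hκlt⟩ : ∃ κ > 0, c + κ < v x₁ - u y₁ :=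
    ⟨(v x₁ - u y₁ - c) / 2, by linarith, by linarith⟩
  have hρ0 : 0 ≤ ρ := (norm_nonneg _).trans hx₁
  set K : Set (EuclideanSpace ℝ (Fin N) × EuclideanSpace ℝ (Fin N)) :=
    {p | ‖p.1‖ = ‖p.2‖ ∧ ‖p.1‖ ≤ ρ} with hKdef
  have hK : IsCompact K := by
    refine ((isCompact_closedBall 0 ρ).prod (isCompact_closedBall 0 ρ)).of_isClosed_subset ?_ ?_
    · exact (isClosed_eq continuous_fst.norm continuous_snd.norm).inter
        (isClosed_le continuous_fst.norm continuous_const)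
    · rintro p ⟨h1, h2⟩
      exact ⟨mem_closedBall_zero_iff.2 h2, mem_closedBall_zero_iff.2 (h1 ▸ h2)⟩
  have hcont : ContinuousOn (fun p : EuclideanSpace ℝ (Fin N) × EuclideanSpace ℝ (Fin N) =>
      v p.1 - u p.2 + κ * ‖p.1‖ ^ 2) K := by
    intro p hp
    have h1 : ‖p.1‖ < 1 := hp.2.trans_lt hρ
    have h2 : ‖p.2‖ < 1 := hp.1 ▸ h1
    refine ContinuousAt.continuousWithinAt ?_
    refine (ContinuousAt.sub ?_ ?_).add (by fun_prop)
    · exact (hCv _ h1).continuousAt.comp continuousAt_fst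
    · exact (hCu _ h2).continuousAt.comp continuousAt_snd
  obtain ⟨⟨x, y⟩, ⟨hxy, hxρ⟩, hmax⟩ := hK.exists_isMaxOn ⟨(x₁, y₁), hxy₁, hx₁⟩ hcont
  simp only at hxy hxρ
  have hmax' : ∀ x' y', ‖x'‖ = ‖y'‖ → ‖x'‖ ≤ ρ →
      v x' - u y' + κ * ‖x'‖ ^ 2 ≤ v x - u y + κ * ‖x‖ ^ 2 := fun x' y' h1 h2 =>
    hmax (show (x', y') ∈ K from ⟨h1, h2⟩)
  have hx1 : ‖x‖ < 1 := hxρ.trans_lt hρ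
  have hy1 : ‖y‖ < 1 := hxy ▸ hx1
  have hgap : c < v x - u y := by
    have := hmax' x₁ y₁ hxy₁ hx₁
    have h1 : κ * ‖x‖ ^ 2 ≤ κ * 1 :=
      mul_le_mul_of_nonneg_left (pow_le_one₀ (norm_nonneg _) hx1.le) hκ.le
    have h2 : 0 ≤ κ * ‖x₁‖ ^ 2 := by positivity
    linarith
  have hxρ' : ‖x‖ < ρ := lt_of_le_of_ne hxρ fun h => (hb x y h (hxy ▸ h)).not_gt hgap
  have hcontra : ¬ lapl v x + 2 * κ ≤ lapl u y := by
    rw [hv.2.1 x (mem_ball_zero_iff.2 hx1), hu.2.1 y (mem_ball_zero_iff.2 hy1)]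
    have := hmono (show u y ≤ v x by linarith)
    linarith
  rcases (norm_nonneg x).eq_or_lt with h0 | hpos
  · obtain rfl : x = 0 := norm_eq_zero.1 h0.symm
    obtain rfl : y = 0 := norm_eq_zero.1 (hxy ▸ norm_zero)
    refine hcontra (lapl_add_le_lapl_of_isLocalMax_zero hN hκ.le (hCv _ hx1) (hCu _ hx1) ?_)
    have hnear : ∀ᶠ z : EuclideanSpace ℝ (Fin N) in 𝓝 0, ‖z‖ < ρ :=
      continuous_norm.continuousAt.eventually (gt_mem_nhds hxρ')
    filter_upwards [hnear] with z hz using hmax' z z rfl hz.le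
  · set r := ‖x‖ with hr
    have hunit : ∀ z : EuclideanSpace ℝ (Fin N), ‖z‖ = r → ‖r⁻¹ • z‖ = 1 := fun z hz => by
      rw [norm_smul, hz, norm_inv, Real.norm_of_nonneg hpos.le, inv_mul_cancel₀ hpos.ne']
    have hback : ∀ z : EuclideanSpace ℝ (Fin N), r • r⁻¹ • z = z := fun z =>
      smul_inv_smul₀ hpos.ne' z
    have hωn := hunit x rfl
    have hθn := hunit y hxy.symm
    refine hcontra ?_
    rw [← hback x, ← hback y]
    refine lapl_add_le_lapl_of_isLocalMax_radial hN hpos hκ.le hωn hθn ?_ ?_ ?_ ?_ ?_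
    · rw [hback]; exact hCv x hx1
    · rw [hback]; exact hCu y hy1
    · intro z hz
      have := hmax' z y (hz.trans hxy) (hz.trans_le hxρ)
      rw [hback]; rw [hz] at this; linarith
    · intro z hz
      have := hmax' x z hz.symm hxρ
      rw [hback]; linarith
    · filter_upwards [Ioo_mem_nhds hpos hxρ'] with s hs
      have hns : ∀ z : EuclideanSpace ℝ (Fin N), ‖z‖ = 1 → ‖s • z‖ = s := fun z hz => by
        rw [norm_smul, hz, mul_one, Real.norm_of_nonneg hs.1.le]
      have := hmax' (s • r⁻¹ • x) (s • r⁻¹ • y) ((hns _ hωn).trans (hns _ hθn).symm)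
        ((hns _ hωn).trans_le hs.2.le)
      rw [hns _ hωn] at this
      simpa only [hback] using this

/-- In the radial parameter of `exists_radial_parametrization`, a bound on the gap between the
largest value of `v` and the smallest value of `u` on a sphere holds on all larger spheres. -/
lemma sub_le_on_outer_sphere {f : ℝ → ℝ} (hN : 1 ≤ N) (hmono : Monotone f)
    {a : ℝ} (ha : 0 < f a) {u v : EuclideanSpace ℝ (Fin N) → ℝ} (hu : IsLargeSolution f u)
    (hv : IsLargeSolution f v) {H : ℝ → ℝ} {τ A : ℝ} (hA : 0 < A) (hH0 : H 0 = 1)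
    (hH : ∀ s ∈ Ioo (-τ) τ, 0 < H s ∧ HasDerivAt H (H s ^ (N - 1)) s)
    (hdec : ∀ ε s : ℝ, 0 < ε → ε < τ → ε * A < 1 → s ∈ Ioo (-τ) 0 →
      (1 - ε * A) * H ((1 - ε * A) * s + ε) ^ (N - 1) < H s ^ (N - 1))
    {s₀ s₁ c : ℝ} (hs₀ : -τ < s₀) (hs₀₁ : s₀ < s₁) (hs₁ : s₁ < 0) (hc : 0 ≤ c)
    (hua : ∀ y ∈ ball (0 : EuclideanSpace ℝ (Fin N)) 1, H s₀ ≤ ‖y‖ → a ≤ u y)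
    (hb : ∀ x y, ‖x‖ = H s₀ → ‖y‖ = H s₀ → v x - u y ≤ c) :
    ∀ x y, ‖x‖ = H s₁ → ‖y‖ = H s₁ → v x - u y ≤ c := by
  intro x₁ y₁ hx₁ hy₁
  by_contra! hlt
  have hCv : ∀ x, ‖x‖ < 1 → ContDiffAt ℝ 2 v x := fun x hx =>
    hv.1.contDiffAt (isOpen_ball.mem_nhds (mem_ball_zero_iff.2 hx))
  have hCu : ∀ x, ‖x‖ < 1 → ContDiffAt ℝ 2 u x := fun x hx =>
    hu.1.contDiffAt (isOpen_ball.mem_nhds (mem_ball_zero_iff.2 hx))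
  have hτ : 0 < τ := by linarith
  have hcd : ∀ s ∈ Ioo (-τ) τ, ContinuousAt H s := fun s hs => (hH s hs).2.continuousAt
  have hHmono : StrictMonoOn H (Ioo (-τ) τ) := strictMonoOn_of_hasDerivAt_pow hH
  have hneg : ∀ s, -τ < s → s < 0 → s ∈ Ioo (-τ) τ := fun s h1 h2 => ⟨h1, by linarith⟩
  have hH1 : ∀ s, -τ < s → s < 0 → H s < 1 := fun s h1 h2 => by
    rw [← hH0]
    exact hHmono (hneg s h1 h2) ⟨by linarith, hτ⟩ h2
  have hnorm : ∀ s (z : EuclideanSpace ℝ (Fin N)), -τ < s → s < 0 → ‖z‖ = 1 →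
      ‖H s • z‖ = H s := fun s z h1 h2 hz => by
    rw [norm_smul, hz, mul_one, Real.norm_of_nonneg (hH s (hneg s h1 h2)).1.le]
  have hunit : ∀ s (z : EuclideanSpace ℝ (Fin N)), -τ < s → s < 0 → ‖z‖ = H s →
      ‖(H s)⁻¹ • z‖ = 1 ∧ H s • (H s)⁻¹ • z = z := fun s z h1 h2 hz => by
    have hp := (hH s (hneg s h1 h2)).1
    refine ⟨?_, smul_inv_smul₀ hp.ne' z⟩
    rw [norm_smul, hz, norm_inv, Real.norm_of_nonneg hp.le, inv_mul_cancel₀ hp.ne']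
  have hs₁' : -τ < s₁ := hs₀.trans hs₀₁
  have hs₀' : s₀ < 0 := hs₀₁.trans hs₁
  obtain ⟨hω₁, hωx⟩ := hunit s₁ x₁ hs₁' hs₁ hx₁
  obtain ⟨hθ₁, hθy⟩ := hunit s₁ y₁ hs₁' hs₁ hy₁
  set ω₁ := (H s₁)⁻¹ • x₁
  set θ₁ := (H s₁)⁻¹ • y₁
  obtain ⟨c', hcc', hc'⟩ := exists_between hlt
  -- continuity of the shifted values of `u` in the shift
  have hushift : ∀ s (θ : EuclideanSpace ℝ (Fin N)), -τ < s → s < 0 → ‖θ‖ = 1 →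
      ContinuousAt (fun p : ℝ × EuclideanSpace ℝ (Fin N) =>
        u (H ((1 - p.1 * A) * s + p.1) • p.2)) (0, θ) := by
    intro s θ h1 h2 hθ
    have e : (1 - (0 : ℝ) * A) * s + 0 = s := by ring
    have hσ : ContinuousAt (fun p : ℝ × EuclideanSpace ℝ (Fin N) =>
        (1 - p.1 * A) * s + p.1) (0, θ) := by fun_prop
    have hHσ : ContinuousAt (fun p : ℝ × EuclideanSpace ℝ (Fin N) =>
        H ((1 - p.1 * A) * s + p.1)) (0, θ) :=
      ContinuousAt.comp (g := H) (by simpa only [e] using hcd s (hneg s h1 h2)) hσ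
    refine ContinuousAt.comp (g := u) ?_ (hHσ.smul continuousAt_snd)
    refine (hCu _ ?_).continuousAt
    simp only [e]
    rw [hnorm s θ h1 h2 hθ]
    exact hH1 s h1 h2
  obtain ⟨ε, ⟨⟨hετ, hεA⟩, hstart, hσ₁, hval⟩, hε⟩ : ∃ ε : ℝ, ((ε < τ ∧ ε * A < 1) ∧
      (∀ θ ∈ sphere (0 : EuclideanSpace ℝ (Fin N)) 1,
        u (H s₀ • θ) - (c' - c) < u (H ((1 - ε * A) * s₀ + ε) • θ)) ∧
      (1 - ε * A) * s₁ + ε < 0 ∧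
      c' < v x₁ - u (H ((1 - ε * A) * s₁ + ε) • θ₁)) ∧ 0 < ε := by
    have hev1 : ∀ᶠ ε : ℝ in 𝓝 0, ε < τ ∧ ε * A < 1 :=
      (gt_mem_nhds hτ).and (ContinuousAt.eventually_lt (by fun_prop) continuousAt_const (by simp))
    have hev2 : ∀ᶠ ε : ℝ in 𝓝 0, ∀ θ ∈ sphere (0 : EuclideanSpace ℝ (Fin N)) 1,
        u (H s₀ • θ) - (c' - c) < u (H ((1 - ε * A) * s₀ + ε) • θ) := by
      refine (isCompact_sphere 0 1).eventually_forall_of_forall_eventually fun θ hθ => ?_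
      have hθ' := mem_sphere_zero_iff_norm.1 hθ
      refine ContinuousAt.eventually_lt ?_ (hushift s₀ θ hs₀ hs₀' hθ') (by simp; linarith)
      have hsmul : ContinuousAt (fun p : ℝ × EuclideanSpace ℝ (Fin N) => H s₀ • p.2) (0, θ) := by
        fun_prop
      refine ContinuousAt.sub (ContinuousAt.comp (g := u) ?_ hsmul) continuousAt_const
      refine (hCu _ ?_).continuousAt
      rw [hnorm s₀ θ hs₀ hs₀' hθ']
      exact hH1 s₀ hs₀ hs₀'
    have hev3 : ∀ᶠ ε : ℝ in 𝓝 0, (1 - ε * A) * s₁ + ε < 0 :=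
      ContinuousAt.eventually_lt (by fun_prop) continuousAt_const (by simpa using hs₁)
    have hev4 : ∀ᶠ ε : ℝ in 𝓝 0, c' < v x₁ - u (H ((1 - ε * A) * s₁ + ε) • θ₁) := by
      refine ContinuousAt.eventually_lt continuousAt_const (continuousAt_const.sub ?_)
        (by simpa [hθy] using hc')
      exact ContinuousAt.comp (x := (0 : ℝ)) (f := fun ε : ℝ => (ε, θ₁))
        (hushift s₁ θ₁ hs₁' hs₁ hθ₁) (by fun_prop)
    have h := (hev1.and (hev2.and (hev3.and hev4))).filter_mono
      (nhdsWithin_le_nhds (s := Ioi (0 : ℝ)))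
    exact (h.and self_mem_nhdsWithin).exists
  set α := 1 - ε * A with hα
  have hα0 : 0 < α := by linarith
  have hα1 : α < 1 := by nlinarith [mul_pos hε hA]
  -- the right end point of the interval of radii
  have hse : -τ < -ε / α ∧ -ε / α < 0 ∧ s₁ < -ε / α := by
    have h1 : s₁ < -ε / α := by rw [lt_div_iff₀ hα0]; linarith
    exact ⟨hs₁'.trans h1, div_neg_of_neg_of_pos (by linarith) hα0, h1⟩
  obtain ⟨Kv, hKv⟩ : ∃ Kv, ∀ x, ‖x‖ ≤ H (-ε / α) → v x ≤ Kv := by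
    have hcont : ContinuousOn v (closedBall 0 (H (-ε / α))) := fun x hx =>
      (hCv x ((mem_closedBall_zero_iff.1 hx).trans_lt
        (hH1 _ hse.1 hse.2.1))).continuousAt.continuousWithinAt
    obtain ⟨Kv, h⟩ := (isCompact_closedBall _ _).bddAbove_image hcont
    exact ⟨Kv, fun x hx => h ⟨x, mem_closedBall_zero_iff.2 hx, rfl⟩⟩
  obtain ⟨b, hb1, hbu⟩ := exists_radius_forall_lt hu.2.2 (Kv - c')
  obtain ⟨t, hbt, ht⟩ : ∃ t, b < H t ∧ t ∈ Ioo (α * s₁ + ε) 0 := by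
    have hev : ∀ᶠ t in 𝓝[<] (0 : ℝ), b < H t :=
      ((hcd 0 ⟨by linarith, hτ⟩).eventually (lt_mem_nhds (by rwa [hH0]))).filter_mono
        nhdsWithin_le_nhds
    exact (hev.and (Ioo_mem_nhdsLT hσ₁)).exists
  have hsb : α * ((t - ε) / α) + ε = t := by field_simp; ring
  set sb := (t - ε) / α
  have hsbe : sb < -ε / α := div_lt_div_of_pos_right (by linarith [ht.2]) hα0
  have hs₁b : s₁ < sb := by
    have := ht.1
    rw [← hsb] at this
    nlinarith
  have hsb0 : sb < 0 := hsbe.trans hse.2.1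
  have hσ : ∀ s ∈ Icc s₀ sb, s < α * s + ε ∧ α * s + ε < 0 := fun s hs => by
    have h1 : s < 0 := hs.2.trans_lt hsb0
    constructor
    · rw [hα]; nlinarith [mul_pos hε hA]
    · have := mul_le_mul_of_nonneg_left hs.2 hα0.le
      linarith [ht.2]
  have hIcc : ∀ s ∈ Icc s₀ sb, -τ < s ∧ s < 0 := fun s hs =>
    ⟨hs₀.trans_le hs.1, hs.2.trans_lt hsb0⟩
  set K : Set (ℝ × EuclideanSpace ℝ (Fin N) × EuclideanSpace ℝ (Fin N)) :=
    Icc s₀ sb ×ˢ sphere 0 1 ×ˢ sphere 0 1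
  have hK : IsCompact K := isCompact_Icc.prod ((isCompact_sphere 0 1).prod (isCompact_sphere 0 1))
  have hcont : ContinuousOn (fun p : ℝ × EuclideanSpace ℝ (Fin N) × EuclideanSpace ℝ (Fin N) =>
      v (H p.1 • p.2.1) - u (H (α * p.1 + ε) • p.2.2)) K := by
    rintro ⟨s, ω, θ⟩ ⟨hs, hω, hθ⟩
    simp only at hs hω hθ
    rw [mem_sphere_zero_iff_norm] at hω hθ
    obtain ⟨h1, h2⟩ := hIcc s hs
    obtain ⟨h3, h4⟩ := hσ s hs
    refine (ContinuousAt.sub ?_ ?_).continuousWithinAt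
    · refine ContinuousAt.comp (g := v) (hCv _ ?_).continuousAt
        (ContinuousAt.smul (ContinuousAt.comp (g := H) (hcd _ (hneg _ h1 h2)) continuousAt_fst)
          (by fun_prop))
      simp only
      rw [hnorm s ω h1 h2 hω]
      exact hH1 s h1 h2
    · have hHσ : ContinuousAt (fun p : ℝ × EuclideanSpace ℝ (Fin N) × EuclideanSpace ℝ (Fin N) =>
          H (α * p.1 + ε)) (s, ω, θ) :=
        ContinuousAt.comp (g := H) (hcd _ (hneg _ (h1.trans h3) h4)) (by fun_prop)
      refine ContinuousAt.comp (g := u) (hCu _ ?_).continuousAt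
        (hHσ.smul (by fun_prop))
      simp only
      rw [hnorm _ θ (h1.trans h3) h4 hθ]
      exact hH1 _ (h1.trans h3) h4
  have hK₁ : (s₁, ω₁, θ₁) ∈ K := ⟨⟨hs₀₁.le, hs₁b.le⟩, mem_sphere_zero_iff_norm.2 hω₁,
    mem_sphere_zero_iff_norm.2 hθ₁⟩
  obtain ⟨⟨s, ω, θ⟩, ⟨hs, hω, hθ⟩, hmax⟩ := hK.exists_isMaxOn ⟨_, hK₁⟩ hcont
  simp only at hs hω hθ
  rw [mem_sphere_zero_iff_norm] at hω hθ
  have hmax' : ∀ s' ∈ Icc s₀ sb, ∀ ω' θ', ‖ω'‖ = 1 → ‖θ'‖ = 1 →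
      v (H s' • ω') - u (H (α * s' + ε) • θ') ≤ v (H s • ω) - u (H (α * s + ε) • θ) :=
    fun s' hs' ω' θ' hω' hθ' => hmax (show (s', ω', θ') ∈ K from
      ⟨hs', mem_sphere_zero_iff_norm.2 hω', mem_sphere_zero_iff_norm.2 hθ'⟩)
  have hgap : c' < v (H s • ω) - u (H (α * s + ε) • θ) := by
    have := hmax' s₁ hK₁.1 ω₁ θ₁ hω₁ hθ₁
    rw [hωx] at this
    exact hval.trans_le this
  obtain ⟨h1, h2⟩ := hIcc s hs
  obtain ⟨h3, h4⟩ := hσ s hs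
  have hnv := hnorm s ω h1 h2 hω
  have hnu := hnorm _ θ (h1.trans h3) h4 hθ
  have hne₀ : s₀ < s := by
    refine lt_of_le_of_ne hs.1 ?_
    rintro rfl
    have e1 := hstart θ (mem_sphere_zero_iff_norm.2 hθ)
    have e2 := hb _ _ hnv (hnorm _ θ h1 h2 hθ)
    linarith
  have hneb : s < sb := by
    refine lt_of_le_of_ne hs.2 fun hssb => ?_
    have e1 := hKv (H s • ω) (by
      rw [hnv, hssb]
      exact (hHmono (hneg _ (hs₁'.trans hs₁b) hsb0) (hneg _ hse.1 hse.2.1) hsbe).le)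
    have e2 := hbu (H (α * s + ε) • θ)
      (mem_ball_zero_iff.2 (by rw [hnu]; exact hH1 _ (h1.trans h3) h4))
      (by rw [hnu, hssb, hsb]; exact hbt)
    linarith
  have hpv := (hH s (hneg s h1 h2)).1
  have hpu := (hH _ (hneg _ (h1.trans h3) h4)).1
  have hvball : ‖H s • ω‖ < 1 := by rw [hnv]; exact hH1 s h1 h2
  have huball : ‖H (α * s + ε) • θ‖ < 1 := by rw [hnu]; exact hH1 _ (h1.trans h3) h4
  have hHev : ∀ s', -τ < s' → s' < 0 → ∀ᶠ s in 𝓝 s', HasDerivAt H (H s ^ (N - 1)) s :=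
    fun s' h1 h2 => by
      filter_upwards [Ioo_mem_nhds h1 (h2.trans hτ)] with s hs using (hH s hs).2
  have hkey := mul_lapl_le_mul_lapl_of_isLocalMax (H := H) (α := α) (β := ε) (s₀ := s) hN hω hθ
    hpv hpu (hHev s h1 h2) (hHev _ (h1.trans h3) h4) (hCv _ hvball) (hCu _ huball)
    (fun y hy => by
      obtain ⟨e1, e2⟩ := hunit s y h1 h2 hy
      have := hmax' s hs _ θ e1 hθ
      rw [e2] at this
      linarith)
    (fun y hy => by
      obtain ⟨e1, e2⟩ := hunit _ y (h1.trans h3) h4 hy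
      have := hmax' s hs ω _ hω e1
      rw [e2] at this
      linarith)
    (by
      filter_upwards [Icc_mem_nhds hne₀ hneb] with s' hs' using hmax' s' hs' ω θ hω hθ)
  rw [hv.2.1 _ (mem_ball_zero_iff.2 hvball), hu.2.1 _ (mem_ball_zero_iff.2 huball)] at hkey
  have hfu : f a ≤ f (u (H (α * s + ε) • θ)) := hmono (hua _ (mem_ball_zero_iff.2 huball) (by
    rw [hnu]
    exact (hHmono (hneg _ hs₀ hs₀') (hneg _ (h1.trans h3) h4) (hs.1.trans_lt h3)).le))
  have hfv : f (u (H (α * s + ε) • θ)) ≤ f (v (H s • ω)) := hmono (by linarith)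
  have hspeed : (α * H (α * s + ε) ^ (N - 1)) ^ 2 < (H s ^ (N - 1)) ^ 2 :=
    pow_lt_pow_left₀ (hdec ε s hε hετ hεA ⟨h1, h2⟩) (by positivity) two_ne_zero
  have e1 := mul_lt_mul_of_pos_right hspeed (ha.trans_le hfu)
  have e2 := mul_le_mul_of_nonneg_left hfv (sq_nonneg (H s ^ (N - 1)))
  linarith

/-- The Keller–Osserman condition fails for bounded nonlinearities. -/
lemma not_integrableOn_one_div_sqrt {f F : ℝ → ℝ} (hf : Continuous f) (hmono : Monotone f)
    {a C M : ℝ} (ha : 0 < f a) (hF : ∀ t, F t = ∫ s in a..t, f s) (hC : ∀ t, f t ≤ C)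
    (hM : a < M) : ¬ IntegrableOn (fun t => 1 / Real.sqrt (F t)) (Ici M) := by
  intro hint
  have hCpos : 0 < C := ha.trans_le (hC a)
  set D := C * (1 + |a|)
  have hD : 0 < D := by positivity
  have hsub : Ioi (max M 1) ⊆ Ici M := fun t ht => (le_max_left M 1).trans (le_of_lt ht)
  have hpow : IntegrableOn (fun t : ℝ => t ^ (-(1 / 2) : ℝ)) (Ioi (max M 1)) := by
    refine Integrable.mono' ((hint.mono_set hsub).const_mul √D)
      (by fun_prop : Measurable fun t : ℝ => t ^ (-(1 / 2) : ℝ)).aestronglyMeasurable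
      ((ae_restrict_iff' measurableSet_Ioi).2 (Eventually.of_forall fun t ht => ?_))
    have hMt : M < t := (le_max_left M 1).trans_lt ht
    have h1t : 1 < t := (le_max_right M 1).trans_lt ht
    have hat : a < t := hM.trans hMt
    have hupper : F t ≤ D * t := by
      have h := intervalIntegral.integral_mono_on hat.le (hf.intervalIntegrable a t)
        (_root_.intervalIntegrable_const (μ := volume) (c := C)) fun s _ => hC s
      rw [← hF, intervalIntegral.integral_const, smul_eq_mul] at h
      have h1 : t - a ≤ (1 + |a|) * t := by nlinarith [neg_abs_le a, abs_nonneg a]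
      have h2 := mul_le_mul_of_nonneg_left h1 hCpos.le
      calc F t ≤ (t - a) * C := h
        _ ≤ D * t := by linarith
    have hlower : 0 < F t := by
      have h := intervalIntegral.integral_mono_on hat.le
        (_root_.intervalIntegrable_const (μ := volume) (c := f a)) (hf.intervalIntegrable a t)
        fun s hs => hmono hs.1
      rw [← hF, intervalIntegral.integral_const, smul_eq_mul] at h
      exact (mul_pos (sub_pos.2 hat) ha).trans_le h
    have hsqrt : √(F t) ≤ √D * √t := by
      rw [← Real.sqrt_mul hD.le]
      exact Real.sqrt_le_sqrt hupper
    rw [Real.norm_of_nonneg (by positivity), Real.rpow_neg (by positivity), ← Real.sqrt_eq_rpow,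
      mul_one_div, le_div_iff₀ (Real.sqrt_pos.2 hlower), inv_mul_le_iff₀ (by positivity), mul_comm]
    exact hsqrt
  rw [integrableOn_Ioi_rpow_iff (by positivity)] at hpow
  norm_num at hpow

lemma Monotone.le_of_forall_add_le {f : ℝ → ℝ} (hmono : Monotone f) {c t₁ : ℝ} (hc : 0 < c)
    (h : ∀ t, t₁ ≤ t → f (t + c) ≤ f t) (t : ℝ) : f t ≤ f t₁ := by
  have hn : ∀ n : ℕ, f (t₁ + n * c) ≤ f t₁ := by
    intro n
    induction n with
    | zero => simp
    | succ n ih =>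
      have := h (t₁ + n * c) (by have : 0 ≤ n * c := by positivity
                                 linarith)
      rw [add_assoc] at this
      push_cast
      rw [add_one_mul]
      exact this.trans ih
  obtain ⟨n, hn'⟩ := exists_nat_ge ((t - t₁) / c)
  rw [div_le_iff₀ hc] at hn'
  exact (hmono (by linarith)).trans (hn n)

/-- A positive gap between the largest value of `v` and the smallest value of `u` on the same
sphere, which is maximal and attained on every sphere near the boundary, forces `f` to be
`c`-periodic near infinity. -/
lemma exists_forall_add_le {f : ℝ → ℝ} (hN : 1 ≤ N)
    {u v : EuclideanSpace ℝ (Fin N) → ℝ} (hu : IsLargeSolution f u) (hv : IsLargeSolution f v)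
    {ρ c : ℝ} (hρ : 0 < ρ) (hρ1 : ρ < 1)
    (hb : ∀ x y, ‖x‖ = ‖y‖ → ‖x‖ < 1 → v x - u y ≤ c)
    (hatt : ∀ r, ρ ≤ r → r < 1 → ∃ x y, ‖x‖ = r ∧ ‖y‖ = r ∧ v x - u y = c) :
    ∃ t₁, ∀ t, t₁ ≤ t → f (t + c) ≤ f t := by
  have hCv : ∀ x, ‖x‖ < 1 → ContDiffAt ℝ 2 v x := fun x hx =>
    hv.1.contDiffAt (isOpen_ball.mem_nhds (mem_ball_zero_iff.2 hx))
  have hCu : ∀ x, ‖x‖ < 1 → ContDiffAt ℝ 2 u x := fun x hx =>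
    hu.1.contDiffAt (isOpen_ball.mem_nhds (mem_ball_zero_iff.2 hx))
  obtain ⟨t₁, ht₁⟩ : ∃ t₁, ∀ x, ‖x‖ ≤ ρ → u x ≤ t₁ := by
    have hcont : ContinuousOn u (closedBall 0 ρ) := fun x hx =>
      (hCu x ((mem_closedBall_zero_iff.1 hx).trans_lt hρ1)).continuousAt.continuousWithinAt
    obtain ⟨K, h⟩ := (isCompact_closedBall _ _).bddAbove_image hcont
    exact ⟨K, fun x hx => h ⟨x, mem_closedBall_zero_iff.2 hx, rfl⟩⟩
  refine ⟨t₁, fun t ht => ?_⟩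
  obtain ⟨b, hb1, hbu⟩ := exists_radius_forall_lt hu.2.2 t
  -- the last sphere touching the sublevel set
  obtain ⟨y, ⟨hy1, hyt⟩, hylast⟩ : ∃ y, (‖y‖ < 1 ∧ u y ≤ t) ∧
      ∀ z, ‖z‖ < 1 → u z ≤ t → ‖z‖ ≤ ‖y‖ := by
    have hcont : ContinuousOn u (closedBall 0 b) := fun x hx =>
      (hCu x ((mem_closedBall_zero_iff.1 hx).trans_lt hb1)).continuousAt.continuousWithinAt
    have hK : IsCompact (closedBall 0 b ∩ u ⁻¹' Iic t) :=
      (isCompact_closedBall 0 b).of_isClosed_subset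
        (hcont.preimage_isClosed_of_isClosed isClosed_closedBall isClosed_Iic) inter_subset_left
    have hmem : ∀ z, ‖z‖ < 1 → u z ≤ t → z ∈ closedBall 0 b ∩ u ⁻¹' Iic t := fun z hz hzt =>
      ⟨mem_closedBall_zero_iff.2 (not_lt.1 fun h =>
        (hbu z (mem_ball_zero_iff.2 hz) h).not_ge hzt), hzt⟩
    obtain ⟨y, hy, hmax⟩ := hK.exists_isMaxOn
      ⟨0, hmem 0 (by simp) ((ht₁ 0 (by simpa using hρ.le)).trans ht)⟩
      continuous_norm.continuousOn
    exact ⟨y, ⟨(mem_closedBall_zero_iff.1 hy.1).trans_lt hb1, hy.2⟩,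
      fun z hz hzt => hmax (hmem z hz hzt)⟩
  set r := ‖y‖
  have hρr : ρ ≤ r := by
    obtain ⟨x, _, hx, -⟩ := hatt ρ le_rfl hρ1
    rw [← hx]
    exact hylast x (hx.trans_lt hρ1) ((ht₁ x hx.le).trans ht)
  have hr : 0 < r := hρ.trans_le hρr
  have hsphere : ∀ z, ‖z‖ = r → t ≤ u z := by
    intro z hz
    have hcont : ContinuousAt (fun s : ℝ => u (s • z)) 1 :=
      ContinuousAt.comp (g := u) (hCu _ (by rw [one_smul, hz]; exact hy1)).continuousAt
        (by fun_prop)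
    have hlim : Tendsto (fun s : ℝ => u (s • z)) (𝓝[>] 1) (𝓝 (u z)) := by
      simpa using hcont.tendsto.mono_left nhdsWithin_le_nhds
    refine ge_of_tendsto hlim ?_
    filter_upwards [Ioo_mem_nhdsGT ((one_lt_inv₀ hr).2 hy1)] with s hs
    have hsz : ‖s • z‖ = s * r := by
      rw [norm_smul, hz, Real.norm_of_nonneg (by linarith [hs.1])]
    by_contra! hlt
    have h1 : s * r < 1 := by
      have := mul_lt_mul_of_pos_right hs.2 hr
      rwa [inv_mul_cancel₀ hr.ne'] at this
    have h2 := hylast (s • z) (hsz.trans_lt h1) hlt.le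
    rw [hsz] at h2
    nlinarith [hs.1]
  obtain ⟨x, y', hx, hy', hxy⟩ := hatt r hρr hy1
  have hy't : u y' = t := by
    have h1 := hb x y hx (hx.trans_lt hy1)
    exact le_antisymm (by linarith) (hsphere y' hy')
  have hunit : ∀ z : EuclideanSpace ℝ (Fin N), ‖z‖ = r → ‖r⁻¹ • z‖ = 1 := fun z hz => by
    rw [norm_smul, hz, norm_inv, Real.norm_of_nonneg hr.le, inv_mul_cancel₀ hr.ne']
  have hback : ∀ z : EuclideanSpace ℝ (Fin N), r • r⁻¹ • z = z := fun z =>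
    smul_inv_smul₀ hr.ne' z
  have hx1 : ‖x‖ < 1 := hx.trans_lt hy1
  have hy'1 : ‖y'‖ < 1 := hy'.trans_lt hy1
  have hkey := lapl_add_le_lapl_of_isLocalMax_radial (v := v) (u := u) (κ := 0) hN hr le_rfl
    (hunit x hx) (hunit y' hy') (by rw [hback]; exact hCv x hx1) (by rw [hback]; exact hCu y' hy'1)
    (fun z hz => by
      have := hb z y' (hz.trans hy'.symm) (hz.trans_lt hy1)
      rw [hback]; linarith)
    (fun z hz => by
      have := hsphere z hz
      rw [hback]; linarith)
    (by
      filter_upwards [Ioo_mem_nhds hr hy1] with s hs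
      have hns : ∀ z : EuclideanSpace ℝ (Fin N), ‖z‖ = 1 → ‖s • z‖ = s := fun z hz => by
        rw [norm_smul, hz, mul_one, Real.norm_of_nonneg hs.1.le]
      have := hb (s • r⁻¹ • x) (s • r⁻¹ • y')
        ((hns _ (hunit x hx)).trans (hns _ (hunit y' hy')).symm)
        ((hns _ (hunit x hx)).trans_lt hs.2)
      simp only [hback, zero_mul, add_zero]
      linarith)
  rw [hback, hback, hv.2.1 x (mem_ball_zero_iff.2 hx1), hu.2.1 y' (mem_ball_zero_iff.2 hy'1),
    hy't, show v x = t + c by linarith] at hkey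
  linarith

/-- Any two large solutions are ordered. -/
lemma IsLargeSolution.le {f : ℝ → ℝ} (hN : 1 ≤ N) (hf : Continuous f) (hmono : Monotone f)
    {a : ℝ} (ha : 0 < f a) {F : ℝ → ℝ} (hF : ∀ t, F t = ∫ s in a..t, f s)
    (hKO : ∃ M, a < M ∧ IntegrableOn (fun t => 1 / Real.sqrt (F t)) (Ici M))
    {u v : EuclideanSpace ℝ (Fin N) → ℝ} (hu : IsLargeSolution f u) (hv : IsLargeSolution f v)
    {x₀ : EuclideanSpace ℝ (Fin N)} (hx₀ : ‖x₀‖ < 1) : v x₀ ≤ u x₀ := by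
  by_contra! hlt
  have hCv : ∀ x, ‖x‖ < 1 → ContDiffAt ℝ 2 v x := fun x hx =>
    hv.1.contDiffAt (isOpen_ball.mem_nhds (mem_ball_zero_iff.2 hx))
  have hCu : ∀ x, ‖x‖ < 1 → ContDiffAt ℝ 2 u x := fun x hx =>
    hu.1.contDiffAt (isOpen_ball.mem_nhds (mem_ball_zero_iff.2 hx))
  obtain ⟨H, τ, A, hτ, hA, hH0, hH, hdec⟩ := exists_radial_parametrization (N - 1)
  obtain ⟨b, hb1, hbu⟩ := exists_radius_forall_lt hu.2.2 a
  have hcd : ∀ s ∈ Ioo (-τ) τ, ContinuousAt H s := fun s hs => (hH s hs).2.continuousAt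
  have hHmono : StrictMonoOn H (Ioo (-τ) τ) := strictMonoOn_of_hasDerivAt_pow hH
  have h0 : (0 : ℝ) ∈ Ioo (-τ) τ := ⟨by linarith, hτ⟩
  obtain ⟨s₀, hs₀, hbs, hxs⟩ : ∃ s ∈ Ioo (-τ) 0, b < H s ∧ ‖x₀‖ < H s := by
    have hev := (((hcd 0 h0).eventually (lt_mem_nhds (hb1.trans_eq hH0.symm))).and
      ((hcd 0 h0).eventually (lt_mem_nhds (hx₀.trans_eq hH0.symm)))).filter_mono
        (nhdsWithin_le_nhds (s := Iio 0))
    obtain ⟨s, h, hs⟩ := (hev.and (Ioo_mem_nhdsLT h0.1)).exists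
    exact ⟨s, hs, h⟩
  have hs₀τ : s₀ ∈ Ioo (-τ) τ := ⟨hs₀.1, hs₀.2.trans hτ⟩
  set ρ := H s₀
  have hρ : 0 < ρ := (hH s₀ hs₀τ).1
  have hρ1 : ρ < 1 := hH0 ▸ hHmono hs₀τ h0 hs₀.2
  have hmaxpair : ∀ r, 0 ≤ r → r < 1 → ∃ x y, ‖x‖ = r ∧ ‖y‖ = r ∧
      ∀ x' y', ‖x'‖ = r → ‖y'‖ = r → v x' - u y' ≤ v x - u y := by
    intro r hr hr1
    have : Nonempty (Fin N) := ⟨⟨0, hN⟩⟩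
    have hne : (sphere (0 : EuclideanSpace ℝ (Fin N)) r).Nonempty :=
      NormedSpace.sphere_nonempty.2 hr
    have hcv : ContinuousOn v (sphere 0 r) := fun x hx =>
      (hCv x ((mem_sphere_zero_iff_norm.1 hx).trans_lt hr1)).continuousAt.continuousWithinAt
    have hcu : ContinuousOn u (sphere 0 r) := fun x hx =>
      (hCu x ((mem_sphere_zero_iff_norm.1 hx).trans_lt hr1)).continuousAt.continuousWithinAt
    obtain ⟨x, hx, hxmax⟩ := (isCompact_sphere 0 r).exists_isMaxOn hne hcv
    obtain ⟨y, hy, hymin⟩ := (isCompact_sphere 0 r).exists_isMinOn hne hcu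
    exact ⟨x, y, mem_sphere_zero_iff_norm.1 hx, mem_sphere_zero_iff_norm.1 hy,
      fun x' y' hx' hy' => sub_le_sub (hxmax (mem_sphere_zero_iff_norm.2 hx'))
        (hymin (mem_sphere_zero_iff_norm.2 hy'))⟩
  obtain ⟨xρ, yρ, hxρ, hyρ, hc⟩ := hmaxpair ρ hρ.le hρ1
  set c := v xρ - u yρ
  have hcpos : 0 < c := by
    by_contra! hc0
    have := sub_le_of_sub_le_on_sphere hN hmono hu hv hρ1 le_rfl
      (fun x y hx hy => (hc x y hx hy).trans hc0) x₀ x₀ rfl hxs.le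
    linarith
  have hout : ∀ r, ρ ≤ r → r < 1 → ∀ x y, ‖x‖ = r → ‖y‖ = r → v x - u y ≤ c := by
    intro r hr hr1
    obtain ⟨s, hs, rfl⟩ : r ∈ H '' Icc s₀ 0 :=
      intermediate_value_Icc hs₀.2.le
        (fun s hs => (hcd s ⟨hs₀.1.trans_le hs.1, hs.2.trans_lt hτ⟩).continuousWithinAt)
        ⟨hr, hH0.symm ▸ hr1.le⟩
    have hs0 : s < 0 := lt_of_le_of_ne hs.2 (by rintro rfl; exact hr1.ne hH0)
    rcases hs.1.eq_or_lt with rfl | hlt'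
    · exact hc
    · exact sub_le_on_outer_sphere hN hmono ha hu hv hA hH0 hH hdec hs₀.1 hlt' hs0 hcpos.le
        (fun y hy hyρ => (hbu y hy (hbs.trans_le hyρ)).le) hc
  have hall : ∀ x y, ‖x‖ = ‖y‖ → ‖x‖ < 1 → v x - u y ≤ c := by
    intro x y hxy hx
    rcases le_total ρ ‖x‖ with h | h
    · exact hout _ h hx x y rfl hxy.symm
    · exact sub_le_of_sub_le_on_sphere hN hmono hu hv hρ1 hcpos.le hc x y hxy h
  have hatt : ∀ r, ρ ≤ r → r < 1 → ∃ x y, ‖x‖ = r ∧ ‖y‖ = r ∧ v x - u y = c := by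
    intro r hr hr1
    obtain ⟨x, y, hx, hy, hmax⟩ := hmaxpair r (hρ.le.trans hr) hr1
    refine ⟨x, y, hx, hy, le_antisymm (hout r hr hr1 x y hx hy) ?_⟩
    have := sub_le_of_sub_le_on_sphere hN hmono hu hv hr1 (le_max_right (v x - u y) 0)
      (fun x' y' hx' hy' => (hmax x' y' hx' hy').trans (le_max_left _ _)) xρ yρ
      (hxρ.trans hyρ.symm) (hxρ.trans_le hr)
    exact (le_max_iff.1 this).resolve_right hcpos.not_ge
  obtain ⟨t₁, ht₁⟩ := exists_forall_add_le hN hu hv hρ hρ1 hall hatt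
  obtain ⟨M, hM, hint⟩ := hKO
  exact not_integrableOn_one_div_sqrt hf hmono ha hF (hmono.le_of_forall_add_le hcpos ht₁) hM hint

end Comparison

theorem stmt3 {N : ℕ} (hN : 1 ≤ N)
    (f : ℝ → ℝ) (hf : Continuous f) (hmono : Monotone f)
    (a : ℝ) (ha : 0 < f a) (hfpos : ∀ t, a < t → 0 ≤ f t)
    (F : ℝ → ℝ) (hF : ∀ t, F t = ∫ s in a..t, f s)
    (hKO : ∃ M, a < M ∧ IntegrableOn (fun t => 1 / Real.sqrt (F t)) (Ici M))
    (u₁ u₂ : EuclideanSpace ℝ (Fin N) → ℝ)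
    (h₁ : IsLargeSolution f u₁) (h₂ : IsLargeSolution f u₂) :
    ∀ x ∈ ball (0 : EuclideanSpace ℝ (Fin N)) 1, u₁ x = u₂ x := by
  intro x hx
  have hx1 := mem_ball_zero_iff.1 hx
  exact le_antisymm (h₂.le hN hf hmono ha hF hKO h₁ hx1) (h₁.le hN hf hmono ha hF hKO h₂ hx1)
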